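/- Let ε, δ > 0 and φ ∈ H_{ε,δ}. Then for every locally integrable function f on R^d (sufficiently nice so that both sides are defined) and every x ∈ R^d, the Carleson maximal function satisfies C^φ(f)(x) ≲_{d,ε,δ} f^♯(x). -/

import Mathlib

open MeasureTheory ENNReal FourierTransform

noncomputable section

/-- The test-function class `H_{ε,δ}`: functions `φ : ℝ^d → ℂ` with
`|φ(x)| ≤ (1+|x|)^{-(d+ε)}`, the Hölder-type condition
`|φ(x)-φ(y)| ≤ |x-y|^δ (1+|x|)^{-(d+ε+δ)} + |x-y|^δ (1+|y|)^{-(d+ε+δ)}`,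
and vanishing integral. -/
def MemHClass (d : ℕ) (ε δ : ℝ) (φ : EuclideanSpace ℝ (Fin d) → ℂ) : Prop :=
  (∀ x, ‖φ x‖ ≤ (1 + ‖x‖) ^ (-((d : ℝ) + ε))) ∧
  (∀ x y, ‖φ x - φ y‖ ≤ ‖x - y‖ ^ δ * (1 + ‖x‖) ^ (-((d : ℝ) + ε + δ)) +
      ‖x - y‖ ^ δ * (1 + ‖y‖) ^ (-((d : ℝ) + ε + δ))) ∧
  (∫ x, φ x) = 0

/-- The dilation `φ_t(x) = t^{-d} φ(x/t)`. -/
def phiDil {d : ℕ} (φ : EuclideanSpace ℝ (Fin d) → ℂ) (t : ℝ)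
    (x : EuclideanSpace ℝ (Fin d)) : ℂ :=
  ((t : ℂ) ^ d)⁻¹ * φ (t⁻¹ • x)

/-- The convolution `φ_t * f (x)`. -/
def phiConv {d : ℕ} (φ : EuclideanSpace ℝ (Fin d) → ℂ)
    (f : EuclideanSpace ℝ (Fin d) → ℂ) (t : ℝ) (x : EuclideanSpace ℝ (Fin d)) : ℂ :=
  ∫ y, phiDil φ t (x - y) * f y

/-- The `g`-function `G^φ(f)(x) = (∫_0^∞ |φ_t * f(x)|² dt/t)^{1/2}`. -/
def gPhi {d : ℕ} (φ : EuclideanSpace ℝ (Fin d) → ℂ)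
    (f : EuclideanSpace ℝ (Fin d) → ℂ) (x : EuclideanSpace ℝ (Fin d)) : ℝ :=
  (∫ t in Set.Ioi (0 : ℝ), ‖phiConv φ f t x‖ ^ 2 / t) ^ (1 / 2 : ℝ)

/-- `φ ∈ H_{ε,δ}` is nondegenerate: there is `ψ ∈ H_{ε,δ}` with
`∫_0^∞ φ̂(tξ) ψ̂(tξ) dt/t = 1` for every `ξ ≠ 0`. -/
def Nondegenerate (d : ℕ) (ε δ : ℝ) (φ : EuclideanSpace ℝ (Fin d) → ℂ) : Prop :=
  ∃ ψ : EuclideanSpace ℝ (Fin d) → ℂ, MemHClass d ε δ ψ ∧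
    ∀ ξ : EuclideanSpace ℝ (Fin d), ξ ≠ 0 →
      (∫ t in Set.Ioi (0 : ℝ), 𝓕 φ (t • ξ) * 𝓕 ψ (t • ξ) / (t : ℂ)) = 1

/-- The axis-parallel closed cube with lower corner `a` and side length `l`. -/
def cube (d : ℕ) (a : Fin d → ℝ) (l : ℝ) : Set (EuclideanSpace ℝ (Fin d)) :=
  {u | ∀ i, u i ∈ Set.Icc (a i) (a i + l)}

/-- The `L²`-sharp maximal function
`f^♯(x) = sup_{Q ∋ x} (|Q|⁻¹ ∫_Q |f(u) - ⟨f⟩_Q|² du)^{1/2}`,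
the supremum running over axis-parallel cubes containing `x`. -/
def sharpMaximal (d : ℕ) (f : EuclideanSpace ℝ (Fin d) → ℂ)
    (x : EuclideanSpace ℝ (Fin d)) : ℝ≥0∞ :=
  ⨆ (a : Fin d → ℝ) (l : ℝ) (_ : 0 < l) (_ : x ∈ cube d a l),
    ((volume (cube d a l))⁻¹ *
      ∫⁻ u in cube d a l, (‖f u - ⨍ v in cube d a l, f v‖₊ : ℝ≥0∞) ^ 2) ^ (1 / 2 : ℝ)

/-- The Carleson maximal function
`C^φ(f)(x) = sup_{Q ∋ x} (|Q|⁻¹ ∫_{T(Q)} |φ_t * f(y)|² dy dt/t)^{1/2}`,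
where `T(Q) = Q × (0, ℓ(Q)]`. -/
def carlesonMax (d : ℕ) (φ f : EuclideanSpace ℝ (Fin d) → ℂ)
    (x : EuclideanSpace ℝ (Fin d)) : ℝ≥0∞ :=
  ⨆ (a : Fin d → ℝ) (l : ℝ) (_ : 0 < l) (_ : x ∈ cube d a l),
    ((volume (cube d a l))⁻¹ *
      ∫⁻ t in Set.Ioc (0 : ℝ) l,
        (∫⁻ y in cube d a l, (‖phiConv φ f t y‖₊ : ℝ≥0∞) ^ 2) / ENNReal.ofReal t) ^ (1 / 2 : ℝ)

section Plancherel

variable {V : Type*} [NormedAddCommGroup V] [InnerProductSpace ℝ V] [FiniteDimensional ℝ V]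
  [MeasurableSpace V] [BorelSpace V]

/-- The integral Fourier transform of a function in `L¹ ∩ L²` represents its `L²` Fourier
transform. -/
theorem fourier_toLp_ae_eq {f : V → ℂ} (hf : Integrable f) (hf2 : MemLp f 2) :
    𝓕 f =ᵐ[volume] (𝓕 (hf2.toLp f) : Lp (α := V) ℂ 2) := by
  have hcont : Continuous (𝓕 f) :=
    VectorFourier.fourierIntegral_continuous Real.continuous_fourierChar
      (L := innerₗ V) continuous_inner hf
  apply ae_eq_of_integral_contDiff_smul_eq hcont.locallyIntegrable
    ((Lp.memLp _).locallyIntegrable one_le_two)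
  intro g g_smooth g_cpt
  have hg₁ : HasCompactSupport (Complex.ofRealCLM ∘ g) := g_cpt.comp_left rfl
  have hg₂ : ContDiff ℝ (⊤ : ℕ∞) (Complex.ofRealCLM ∘ g) := by fun_prop
  set G : SchwartzMap V ℂ := hg₁.toSchwartzMap hg₂ with hG
  have h1 := DFunLike.congr_fun (Lp.fourier_toTemperedDistribution_eq (hf2.toLp f)) G
  rw [TemperedDistribution.fourier_apply, Lp.toTemperedDistribution_apply,
    Lp.toTemperedDistribution_apply] at h1
  have h2 : ∫ ξ, 𝓕 (G : V → ℂ) ξ • f ξ = ∫ x, G x • 𝓕 f x := by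
    simpa using! VectorFourier.integral_fourierIntegral_smul_eq_flip (L := innerₗ V)
      Real.continuous_fourierChar continuous_inner G.integrable hf
  have h3 : ∫ ξ, 𝓕 (G : V → ℂ) ξ • f ξ = ∫ x, (𝓕 G) x • (hf2.toLp f) x := by
    apply integral_congr_ae
    filter_upwards [hf2.coeFn_toLp] with x hx
    rw [hx, SchwartzMap.fourier_coe]
  have h4 : ∀ x, G x = (g x : ℂ) := fun x => by simp [hG]
  simp only [h4] at h1 h2
  simp only [← Complex.coe_smul]
  rw [← h2, h3, h1]

theorem lintegral_fourier_sq {f : V → ℂ} (hf : Integrable f) (hf2 : MemLp f 2) :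
    ∫⁻ ξ, ‖𝓕 f ξ‖ₑ ^ 2 = ∫⁻ x, ‖f x‖ₑ ^ 2 := by
  have key : eLpNorm (𝓕 f) 2 volume = eLpNorm f 2 volume := by
    rw [eLpNorm_congr_ae (fourier_toLp_ae_eq hf hf2), ← Lp.enorm_def,
      ← eLpNorm_congr_ae hf2.coeFn_toLp, ← Lp.enorm_def, ← ofReal_norm, ← ofReal_norm,
      Lp.norm_fourier_eq]
  have h := congrArg (· ^ (2 : ℝ)) key
  simp only [eLpNorm_eq_lintegral_rpow_enorm_toReal two_ne_zero ofNat_ne_top, toReal_ofNat,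
    ← ENNReal.rpow_mul] at h
  simpa using h

end Plancherel

section RpowIntegrals

theorem lintegral_Ioc_rpow {R b : ℝ} (hR : 0 < R) (hb : 0 < b) :
    ∫⁻ t in Set.Ioc 0 R, ENNReal.ofReal (t ^ (b - 1)) = ENNReal.ofReal (R ^ b / b) := by
  have hint : IntervalIntegrable (fun t : ℝ => t ^ (b - 1)) volume 0 R :=
    intervalIntegral.intervalIntegrable_rpow' (by linarith)
  rw [intervalIntegrable_iff_integrableOn_Ioc_of_le hR.le] at hint
  rw [← ofReal_integral_eq_lintegral_ofReal hint, ← intervalIntegral.integral_of_le hR.le,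
    integral_rpow (Or.inl (by linarith))]
  · simp [Real.zero_rpow hb.ne']
  · filter_upwards [ae_restrict_mem measurableSet_Ioc] with t ht
    exact Real.rpow_nonneg ht.1.le _

theorem lintegral_Ioi_rpow {R b : ℝ} (hR : 0 < R) (hb : 0 < b) :
    ∫⁻ t in Set.Ioi R, ENNReal.ofReal (t ^ (-b - 1)) = ENNReal.ofReal (R ^ (-b) / b) := by
  rw [← ofReal_integral_eq_lintegral_ofReal (integrableOn_Ioi_rpow_of_lt (by linarith) hR),
    integral_Ioi_rpow_of_lt (by linarith) hR]
  · congr 1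
    simp only [sub_add_cancel, div_neg, neg_div, neg_neg]
  · filter_upwards [ae_restrict_mem measurableSet_Ioi] with t ht
    exact Real.rpow_nonneg (hR.le.trans (le_of_lt ht)) _

end RpowIntegrals

namespace MemHClass

variable {d : ℕ} {ε δ : ℝ} {φ : EuclideanSpace ℝ (Fin d) → ℂ}

theorem continuous (h : MemHClass d ε δ φ) (hε : 0 < ε) (hδ : 0 < δ) : Continuous φ := by
  rw [continuous_iff_continuousAt]
  intro x
  rw [ContinuousAt, tendsto_iff_norm_sub_tendsto_zero]
  have hb : ∀ z : EuclideanSpace ℝ (Fin d), (1 + ‖z‖) ^ (-((d : ℝ) + ε + δ)) ≤ 1 := fun z =>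
    Real.rpow_le_one_of_one_le_of_nonpos (by linarith [norm_nonneg z]) (by
      have : (0 : ℝ) ≤ d := d.cast_nonneg
      linarith)
  refine squeeze_zero (g := fun y => ‖y - x‖ ^ δ * 1 + ‖y - x‖ ^ δ * 1)
    (fun _ => norm_nonneg _) (fun y => (h.2.1 y x).trans ?_) ?_
  · gcongr <;> exact hb _
  · have : Continuous fun y : EuclideanSpace ℝ (Fin d) => ‖y - x‖ ^ δ * 1 + ‖y - x‖ ^ δ * 1 := by
      have : Continuous fun y : EuclideanSpace ℝ (Fin d) => ‖y - x‖ ^ δ :=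
        (continuous_id.sub continuous_const).norm.rpow_const fun _ => Or.inr hδ.le
      fun_prop
    convert this.tendsto x using 2
    simp [Real.zero_rpow hδ.ne']

theorem norm_le_one (h : MemHClass d ε δ φ) (hε : 0 < ε) (x : EuclideanSpace ℝ (Fin d)) :
    ‖φ x‖ ≤ 1 :=
  (h.1 x).trans <| Real.rpow_le_one_of_one_le_of_nonpos (by linarith [norm_nonneg x]) (by
      have : (0 : ℝ) ≤ d := d.cast_nonneg
      linarith)

theorem integrable (h : MemHClass d ε δ φ) (hε : 0 < ε) (hδ : 0 < δ) : Integrable φ :=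
  (integrable_one_add_norm (r := (d : ℝ) + ε) (by simpa using hε)).mono'
    (h.continuous hε hδ).aestronglyMeasurable (Filter.Eventually.of_forall h.1)

end MemHClass

theorem norm_fourierChar_sub_one_le {a s : ℝ} (ha : 0 ≤ a) (ha1 : a ≤ 1) {r : ℝ} (hr : |r| ≤ s) :
    ‖(Real.fourierChar r : ℂ) - 1‖ ≤ 2 * Real.pi * s ^ a := by
  have hs0 : 0 ≤ s := (abs_nonneg r).trans hr
  have hpi := Real.pi_gt_three
  rcases le_total s 1 with hs | hs
  · have h1 : ‖(Real.fourierChar r : ℂ) - 1‖ ≤ 2 * Real.pi * s := by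
      rw [Real.fourierChar_apply, mul_comm]
      refine Real.norm_exp_I_mul_ofReal_sub_one_le.trans ?_
      rw [Real.norm_eq_abs, abs_mul, abs_of_pos (by positivity : (0 : ℝ) < 2 * Real.pi)]
      gcongr
    refine h1.trans ?_
    gcongr
    exact Real.self_le_rpow_of_le_one hs0 hs ha1
  · have h1 : ‖(Real.fourierChar r : ℂ) - 1‖ ≤ 2 := by
      refine (norm_sub_le _ _).trans ?_
      rw [Circle.norm_coe, norm_one]
      norm_num
    have h2 : 1 ≤ s ^ a := Real.one_le_rpow hs ha
    nlinarith

theorem exists_norm_fourier_le_rpow (d : ℕ) {ε δ : ℝ} (hε : 0 < ε) (hδ : 0 < δ) :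
    ∃ a : ℝ, 0 < a ∧ ∃ C : ℝ, 0 ≤ C ∧ ∀ φ : EuclideanSpace ℝ (Fin d) → ℂ, MemHClass d ε δ φ →
      ∀ ξ, ‖𝓕 φ ξ‖ ≤ C * ‖ξ‖ ^ a := by
  set a := min 1 (ε / 2) with ha_def
  have ha : 0 < a := lt_min one_pos (by linarith)
  have ha1 : a ≤ 1 := min_le_left _ _
  have ha2 : a ≤ ε / 2 := min_le_right _ _
  have hint : Integrable (fun v : EuclideanSpace ℝ (Fin d) =>
      (1 + ‖v‖) ^ (-((d : ℝ) + (ε - a)))) volume :=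
    integrable_one_add_norm (by simp; linarith)
  refine ⟨a, ha, ∫ v : EuclideanSpace ℝ (Fin d), 2 * Real.pi *
    (1 + ‖v‖) ^ (-((d : ℝ) + (ε - a))), integral_nonneg fun v => by positivity, ?_⟩
  intro φ hφ ξ
  have hφi := hφ.integrable hε hδ
  have hφe : Integrable fun v => Real.fourierChar (-inner ℝ v ξ) • φ v :=
    (Real.fourierIntegral_convergent_iff ξ).2 hφi
  have h1 : 𝓕 φ ξ = ∫ v, ((Real.fourierChar (-inner ℝ v ξ) : ℂ) - 1) * φ v := by
    rw [Real.fourier_eq]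
    calc ∫ v, Real.fourierChar (-inner ℝ v ξ) • φ v
        = (∫ v, Real.fourierChar (-inner ℝ v ξ) • φ v) - ∫ v, φ v := by rw [hφ.2.2, sub_zero]
      _ = _ := by
        rw [← integral_sub hφe hφi]
        congr 1 with v
        rw [Circle.smul_def, smul_eq_mul]
        ring
  rw [h1, ← integral_mul_const]
  refine norm_integral_le_of_norm_le ((hint.const_mul _).mul_const _)
    (Filter.Eventually.of_forall fun v => ?_)
  rw [norm_mul]
  have h2 : ‖(Real.fourierChar (-inner ℝ v ξ) : ℂ) - 1‖ ≤
      2 * Real.pi * (‖v‖ * ‖ξ‖) ^ a :=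
    norm_fourierChar_sub_one_le ha.le ha1 (by rw [abs_neg]; exact abs_real_inner_le_norm v ξ)
  have hv : 0 < 1 + ‖v‖ := by positivity
  calc _ ≤ (2 * Real.pi * (‖v‖ * ‖ξ‖) ^ a) * (1 + ‖v‖) ^ (-((d : ℝ) + ε)) := by
        gcongr
        exact hφ.1 v
    _ ≤ (2 * Real.pi * ((1 + ‖v‖) * ‖ξ‖) ^ a) * (1 + ‖v‖) ^ (-((d : ℝ) + ε)) := by
        gcongr
        linarith
    _ = _ := by
        rw [Real.mul_rpow hv.le (norm_nonneg _),
          show -((d : ℝ) + (ε - a)) = a + -((d : ℝ) + ε) by ring, Real.rpow_add hv]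
        ring

theorem exists_norm_fourier_le_rpow_neg (d : ℕ) {ε δ : ℝ} (hε : 0 < ε) (hδ : 0 < δ) :
    ∃ C : ℝ, 0 ≤ C ∧ ∀ φ : EuclideanSpace ℝ (Fin d) → ℂ, MemHClass d ε δ φ →
      ∀ ξ, ξ ≠ 0 → ‖𝓕 φ ξ‖ ≤ C * ‖ξ‖ ^ (-δ) := by
  set w : EuclideanSpace ℝ (Fin d) → ℝ := fun v => (1 + ‖v‖) ^ (-((d : ℝ) + ε + δ)) with hw
  have hint : Integrable w volume := by
    have : (Module.finrank ℝ (EuclideanSpace ℝ (Fin d)) : ℝ) < (d : ℝ) + ε + δ := by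
      simp; linarith
    exact integrable_one_add_norm this
  have hw0 : ∀ v, 0 ≤ w v := fun v => by positivity
  refine ⟨∫ v, w v, integral_nonneg hw0, ?_⟩
  intro φ hφ ξ hξ
  have hξ' : 0 < ‖ξ‖ := norm_pos_iff.2 hξ
  set h : EuclideanSpace ℝ (Fin d) := (1 / (2 * ‖ξ‖ ^ 2) : ℝ) • ξ with hh
  have hnorm : ‖h‖ = (2 * ‖ξ‖)⁻¹ := by
    rw [hh, norm_smul, Real.norm_of_nonneg (by positivity)]
    field_simp
  have hδh : ‖h‖ ^ δ ≤ ‖ξ‖ ^ (-δ) := by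
    rw [hnorm, Real.rpow_neg hξ'.le, ← Real.inv_rpow hξ'.le]
    gcongr
    linarith
  rw [Real.fourier_eq, fourierIntegral_eq_half_sub_half_period_translate hξ
    (hφ.integrable hε hδ), norm_smul]
  have hb : ‖∫ v, Real.fourierChar (-inner ℝ v ξ) • (φ v - φ (v + h))‖ ≤
      ∫ v, ‖h‖ ^ δ * (w v + w (v + h)) := by
    refine norm_integral_le_of_norm_le ((hint.add (hint.comp_add_right h)).const_mul _)
      (Filter.Eventually.of_forall fun v => ?_)
    rw [Circle.smul_def, norm_smul, Circle.norm_coe, one_mul, mul_add]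
    have := hφ.2.1 v (v + h)
    rwa [sub_add_cancel_left, norm_neg] at this
  rw [integral_const_mul, integral_add hint (hint.comp_add_right h),
    integral_add_right_eq_self w h] at hb
  have hI : 0 ≤ ∫ v, w v := integral_nonneg fun v => hw0 v
  calc _ ≤ ‖(1 / 2 : ℂ)‖ * (‖h‖ ^ δ * ((∫ v, w v) + ∫ v, w v)) := by gcongr
    _ = (∫ v, w v) * ‖h‖ ^ δ := by norm_num; ring
    _ ≤ (∫ v, w v) * ‖ξ‖ ^ (-δ) := mul_le_mul_of_nonneg_left hδh hI

theorem exists_lintegral_fourier_sq_le (d : ℕ) {ε δ : ℝ} (hε : 0 < ε) (hδ : 0 < δ) :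
    ∃ K : ℝ≥0∞, K ≠ ⊤ ∧ ∀ φ : EuclideanSpace ℝ (Fin d) → ℂ, MemHClass d ε δ φ →
      ∀ ξ, ∫⁻ t in Set.Ioi (0 : ℝ), ‖𝓕 φ (t • ξ)‖ₑ ^ 2 / ENNReal.ofReal t ≤ K := by
  obtain ⟨a, ha, C, hC, H1⟩ := exists_norm_fourier_le_rpow d hε hδ
  obtain ⟨D, hD, H2⟩ := exists_norm_fourier_le_rpow_neg d hε hδ
  have pointwise : ∀ {z : ℂ} {B b r t : ℝ}, 0 < t → 0 ≤ r → 0 ≤ B →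
      ‖z‖ ≤ B * (t * r) ^ b →
      ‖z‖ₑ ^ 2 / ENNReal.ofReal t ≤
        ENNReal.ofReal (B ^ 2 * r ^ (2 * b)) * ENNReal.ofReal (t ^ (2 * b - 1)) := by
    intro z B b r t ht hr hB hz
    rw [← ofReal_norm, ← ENNReal.ofReal_pow (norm_nonneg _), ← ENNReal.ofReal_div_of_pos ht,
      ← ENNReal.ofReal_mul (by positivity)]
    apply ENNReal.ofReal_le_ofReal
    calc ‖z‖ ^ 2 / t ≤ (B * (t * r) ^ b) ^ 2 / t := by gcongr
      _ = _ := by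
        rw [Real.mul_rpow ht.le hr, Real.rpow_sub_one ht.ne', mul_comm 2 b,
          Real.rpow_mul ht.le, Real.rpow_mul hr, Real.rpow_two, Real.rpow_two]
        ring
  refine ⟨ENNReal.ofReal (C ^ 2 / (2 * a)) + ENNReal.ofReal (D ^ 2 / (2 * δ)), by simp, ?_⟩
  intro φ hφ ξ
  rcases eq_or_ne ξ 0 with rfl | hξ
  · have : 𝓕 φ 0 = 0 := by simpa [Real.fourier_eq] using hφ.2.2
    simp [this]
  have hr : 0 < ‖ξ‖ := norm_pos_iff.2 hξ
  have hR : 0 < ‖ξ‖⁻¹ := inv_pos.2 hr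
  rw [← Set.Ioc_union_Ioi_eq_Ioi hR.le]
  refine (lintegral_union_le _ _ _).trans (add_le_add ?_ ?_)
  · calc _ ≤ ∫⁻ t in Set.Ioc 0 ‖ξ‖⁻¹, ENNReal.ofReal (C ^ 2 * ‖ξ‖ ^ (2 * a)) *
          ENNReal.ofReal (t ^ (2 * a - 1)) := by
          refine setLIntegral_mono' measurableSet_Ioc fun t ht => ?_
          refine pointwise ht.1 hr.le hC ?_
          have := H1 φ hφ (t • ξ)
          rwa [norm_smul, Real.norm_of_nonneg ht.1.le] at this
      _ = _ := by
          rw [lintegral_const_mul' _ _ ofReal_ne_top, lintegral_Ioc_rpow hR (by positivity),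
            ← ENNReal.ofReal_mul (by positivity), Real.inv_rpow hr.le]
          congr 1
          field_simp
  · calc _ ≤ ∫⁻ t in Set.Ioi ‖ξ‖⁻¹, ENNReal.ofReal (D ^ 2 * ‖ξ‖ ^ (2 * -δ)) *
          ENNReal.ofReal (t ^ (-(2 * δ) - 1)) := by
          refine setLIntegral_mono' measurableSet_Ioi fun t ht => ?_
          have ht0 : 0 < t := hR.trans ht
          rw [← mul_neg]
          refine pointwise ht0 hr.le hD ?_
          have := H2 φ hφ (t • ξ) (smul_ne_zero ht0.ne' hξ)
          rwa [norm_smul, Real.norm_of_nonneg ht0.le] at this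
      _ = _ := by
          rw [lintegral_const_mul' _ _ ofReal_ne_top, lintegral_Ioi_rpow hR (by positivity),
            ← ENNReal.ofReal_mul (by positivity), Real.inv_rpow hr.le, mul_neg]
          congr 1
          field_simp

section SquareFunction

variable {d : ℕ} {ε δ : ℝ} {φ h : EuclideanSpace ℝ (Fin d) → ℂ} {t : ℝ}

theorem fourier_phiDil (ht : 0 < t) (ξ : EuclideanSpace ℝ (Fin d)) :
    𝓕 (phiDil φ t) ξ = 𝓕 φ (t • ξ) := by
  have key := Measure.integral_comp_inv_smul (volume : Measure (EuclideanSpace ℝ (Fin d)))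
    (fun v => Real.fourierChar (-inner ℝ v (t • ξ)) • φ v) t
  rw [Real.fourier_eq, Real.fourier_eq]
  have h1 : ∀ v : EuclideanSpace ℝ (Fin d), inner ℝ (t⁻¹ • v) (t • ξ) = inner ℝ v ξ := by
    intro v
    rw [inner_smul_left, inner_smul_right]
    simp [ht.ne']
  simp only [h1, finrank_euclideanSpace, Fintype.card_fin] at key
  have htd : (t : ℂ) ^ d ≠ 0 := pow_ne_zero _ (by exact_mod_cast ht.ne')
  have h2 : ∀ v : EuclideanSpace ℝ (Fin d), Real.fourierChar (-inner ℝ v ξ) • phiDil φ t v =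
      ((t : ℂ) ^ d)⁻¹ * Real.fourierChar (-inner ℝ v ξ) • φ (t⁻¹ • v) := by
    intro v
    simp only [phiDil, Circle.smul_def, smul_eq_mul]
    ring
  simp only [h2]
  rw [integral_const_mul, key, abs_of_pos (pow_pos ht d), Complex.real_smul]
  push_cast
  field_simp

theorem MemHClass.integrable_phiDil (hφ : MemHClass d ε δ φ) (hε : 0 < ε) (hδ : 0 < δ)
    (ht : 0 < t) : Integrable (phiDil φ t) :=
  ((integrable_comp_smul_iff volume φ (inv_ne_zero ht.ne')).2
    (hφ.integrable hε hδ)).const_mul _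

theorem MemHClass.integral_phiDil (hφ : MemHClass d ε δ φ) : ∫ v, phiDil φ t v = 0 := by
  simp only [phiDil]
  rw [integral_const_mul, Measure.integral_comp_inv_smul, hφ.2.2, smul_zero, mul_zero]

theorem MemHClass.norm_phiDil_le (hφ : MemHClass d ε δ φ) (hε : 0 < ε) (ht : 0 < t)
    (x : EuclideanSpace ℝ (Fin d)) : ‖phiDil φ t x‖ ≤ (t ^ d)⁻¹ := by
  rw [phiDil, norm_mul, norm_inv, norm_pow, Complex.norm_real, Real.norm_of_nonneg ht.le]
  exact mul_le_of_le_one_right (by positivity) (hφ.norm_le_one hε _)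

theorem phiConv_eq_convolution :
    phiConv φ h t = convolution h (phiDil φ t) (.mul ℂ ℂ) volume := by
  ext y
  simp only [phiConv, convolution, ContinuousLinearMap.mul_apply', mul_comm]

theorem lintegral_phiConv_sq (hφ : MemHClass d ε δ φ) (hε : 0 < ε) (hδ : 0 < δ)
    (hh : Integrable h) (ht : 0 < t) :
    ∫⁻ y, ‖phiConv φ h t y‖ₑ ^ 2 = ∫⁻ ξ, ‖𝓕 h ξ‖ₑ ^ 2 * ‖𝓕 φ (t • ξ)‖ₑ ^ 2 := by
  have hD := hφ.integrable_phiDil hε hδ ht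
  have hint : Integrable (phiConv φ h t) := by
    rw [phiConv_eq_convolution]
    exact hh.integrable_convolution _ hD
  have hbd : ∀ y, ‖phiConv φ h t y‖ ≤ (t ^ d)⁻¹ * ∫ u, ‖h u‖ := by
    intro y
    rw [← integral_const_mul]
    refine norm_integral_le_of_norm_le (hh.norm.const_mul _)
      (Filter.Eventually.of_forall fun u => ?_)
    rw [norm_mul]
    gcongr
    exact hφ.norm_phiDil_le hε ht _
  have hL2 : MemLp (phiConv φ h t) 2 := by
    rw [memLp_two_iff_integrable_sq_norm hint.aestronglyMeasurable]
    refine (hint.norm.const_mul ((t ^ d)⁻¹ * ∫ u, ‖h u‖)).mono'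
      (hint.aestronglyMeasurable.norm.pow 2) (Filter.Eventually.of_forall fun y => ?_)
    rw [Real.norm_of_nonneg (by positivity), sq]
    gcongr
    exact hbd y
  rw [← lintegral_fourier_sq hint hL2]
  refine lintegral_congr fun ξ => ?_
  rw [phiConv_eq_convolution, Real.fourier_mul_convolution_eq hh hD, fourier_phiDil ht,
    enorm_mul, mul_pow]

theorem exists_lintegral_phiConv_sq_le (d : ℕ) {ε δ : ℝ} (hε : 0 < ε) (hδ : 0 < δ) :
    ∃ K : ℝ≥0∞, K ≠ ⊤ ∧ ∀ φ : EuclideanSpace ℝ (Fin d) → ℂ, MemHClass d ε δ φ →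
      ∀ h : EuclideanSpace ℝ (Fin d) → ℂ, Integrable h → MemLp h 2 →
        ∫⁻ t in Set.Ioi (0 : ℝ), (∫⁻ y, ‖phiConv φ h t y‖ₑ ^ 2) / ENNReal.ofReal t ≤
          K * ∫⁻ y, ‖h y‖ₑ ^ 2 := by
  obtain ⟨K, hK, H⟩ := exists_lintegral_fourier_sq_le d hε hδ
  refine ⟨K, hK, fun φ hφ h hh hh2 => ?_⟩
  have hcont : ∀ {g : EuclideanSpace ℝ (Fin d) → ℂ}, Integrable g → Continuous (𝓕 g) :=
    fun hg => VectorFourier.fourierIntegral_continuous Real.continuous_fourierChar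
      (L := innerₗ _) continuous_inner hg
  have hch := hcont hh
  have hcφ := hcont (hφ.integrable hε hδ)
  calc _ = ∫⁻ t in Set.Ioi (0 : ℝ), ∫⁻ ξ, ‖𝓕 h ξ‖ₑ ^ 2 *
        (‖𝓕 φ (t • ξ)‖ₑ ^ 2 / ENNReal.ofReal t) := by
        refine setLIntegral_congr_fun measurableSet_Ioi fun t ht => ?_
        simp only [lintegral_phiConv_sq hφ hε hδ hh ht, div_eq_mul_inv]
        rw [← lintegral_mul_const' _ _ (by simpa using ht)]
        simp only [mul_assoc]
    _ = ∫⁻ ξ, ∫⁻ t in Set.Ioi (0 : ℝ), ‖𝓕 h ξ‖ₑ ^ 2 *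
        (‖𝓕 φ (t • ξ)‖ₑ ^ 2 / ENNReal.ofReal t) := by
        refine lintegral_lintegral_swap (Measurable.aemeasurable ?_)
        have m1 : Measurable fun p : ℝ × EuclideanSpace ℝ (Fin d) => ‖𝓕 h p.2‖ₑ :=
          (hch.comp continuous_snd).enorm.measurable
        have m2 : Measurable fun p : ℝ × EuclideanSpace ℝ (Fin d) => ‖𝓕 φ (p.1 • p.2)‖ₑ :=
          (hcφ.comp continuous_smul).enorm.measurable
        exact (m1.pow_const 2).mul
          ((m2.pow_const 2).div (ENNReal.measurable_ofReal.comp measurable_fst))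
    _ ≤ ∫⁻ ξ, ‖𝓕 h ξ‖ₑ ^ 2 * K := by
        refine lintegral_mono fun ξ => ?_
        rw [lintegral_const_mul' _ _ (by simp)]
        gcongr
        exact H φ hφ ξ
    _ = _ := by
        rw [lintegral_mul_const' _ _ hK, lintegral_fourier_sq hh hh2, mul_comm]

end SquareFunction

section Cubes

variable {d : ℕ} {a : Fin d → ℝ} {l : ℝ} {x : EuclideanSpace ℝ (Fin d)}
  {f : EuclideanSpace ℝ (Fin d) → ℂ}

theorem cube_eq_preimage (d : ℕ) (a : Fin d → ℝ) (l : ℝ) :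
    cube d a l = WithLp.ofLp ⁻¹' Set.Icc a (fun i => a i + l) := by
  ext u
  simp only [cube, Set.mem_ofPred_eq, Set.mem_preimage, Set.mem_Icc, Pi.le_def, forall_and]

theorem measurableSet_cube : MeasurableSet (cube d a l) := by
  rw [cube_eq_preimage]
  exact (PiLp.continuous_ofLp 2 _).measurable measurableSet_Icc

theorem isCompact_cube : IsCompact (cube d a l) := by
  rw [cube_eq_preimage]
  exact (PiLp.homeomorph 2 fun _ : Fin d => ℝ).isCompact_preimage.2 isCompact_Icc

theorem volume_cube (hl : 0 ≤ l) : volume (cube d a l) = ENNReal.ofReal (l ^ d) := by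
  rw [cube_eq_preimage, (PiLp.volume_preserving_ofLp (Fin d)).measure_preimage
    measurableSet_Icc.nullMeasurableSet, Real.volume_Icc_pi]
  simp [ENNReal.ofReal_pow hl]

theorem lintegral_cube_sub_average_sq_le (hl : 0 < l) (hx : x ∈ cube d a l) :
    ∫⁻ u in cube d a l, ‖f u - ⨍ v in cube d a l, f v‖ₑ ^ 2 ≤
      volume (cube d a l) * sharpMaximal d f x ^ 2 := by
  have hvol : volume (cube d a l) ≠ 0 := by
    rw [volume_cube hl.le]
    simp [hl]
  have h1 : ((volume (cube d a l))⁻¹ *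
      ∫⁻ u in cube d a l, ‖f u - ⨍ v in cube d a l, f v‖ₑ ^ 2) ^ (1 / 2 : ℝ) ≤
      sharpMaximal d f x :=
    le_iSup₂_of_le a l (le_iSup₂_of_le hl hx le_rfl)
  rw [← ENNReal.le_rpow_inv_iff (by norm_num), ← ENNReal.div_eq_inv_mul,
    ENNReal.div_le_iff hvol isCompact_cube.measure_lt_top.ne, mul_comm] at h1
  simpa using h1

theorem lintegral_le_sqrt_mul_sqrt {α : Type*} [MeasurableSpace α] (μ : Measure α) {g : α → ℝ≥0∞}
    (hg : AEMeasurable g μ) :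
    ∫⁻ u, g u ∂μ ≤ (∫⁻ u, g u ^ 2 ∂μ) ^ (1 / 2 : ℝ) * μ Set.univ ^ (1 / 2 : ℝ) := by
  simpa using ENNReal.lintegral_mul_le_Lp_mul_Lq μ Real.HolderConjugate.two_two hg
    (aemeasurable_const (b := (1 : ℝ≥0∞)))

theorem lintegral_cube_sub_average_le (hf : AEStronglyMeasurable f volume) (hl : 0 < l)
    (hx : x ∈ cube d a l) :
    ∫⁻ u in cube d a l, ‖f u - ⨍ v in cube d a l, f v‖ₑ ≤
      volume (cube d a l) * sharpMaximal d f x := by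
  refine (lintegral_le_sqrt_mul_sqrt _
    (hf.restrict.sub aestronglyMeasurable_const).enorm).trans ?_
  rw [Measure.restrict_apply_univ]
  calc _ ≤ (volume (cube d a l) * sharpMaximal d f x ^ 2) ^ (1 / 2 : ℝ) *
        volume (cube d a l) ^ (1 / 2 : ℝ) := by
        gcongr
        exact lintegral_cube_sub_average_sq_le hl hx
    _ = (volume (cube d a l) ^ (1 / 2 : ℝ) * volume (cube d a l) ^ (1 / 2 : ℝ)) *
        sharpMaximal d f x := by
        rw [ENNReal.mul_rpow_of_nonneg _ _ (by norm_num), ← ENNReal.rpow_natCast,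
          ← ENNReal.rpow_mul]
        norm_num
        ring
    _ = _ := by
        rw [← ENNReal.rpow_add_of_nonneg _ _ (by norm_num) (by norm_num)]
        norm_num

theorem enorm_average_sub_le {α : Type*} [MeasurableSpace α] {μ : Measure α} [IsFiniteMeasure μ]
    [NeZero μ] {f : α → ℂ} (hf : Integrable f μ) (c : ℂ) :
    ‖(⨍ u, f u ∂μ) - c‖ₑ ≤ (μ Set.univ)⁻¹ * ∫⁻ u, ‖f u - c‖ₑ ∂μ := by
  have h1 : (⨍ u, f u ∂μ) - c = ⨍ u, (f u - c) ∂μ := by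
    rw [average, average, integral_sub hf.to_average (integrable_const c)]
    simp
  rw [h1, average, ← smul_eq_mul, ← lintegral_smul_measure]
  exact enorm_integral_le_lintegral_enorm _

/-- The cube concentric with `cube d a l`, with side length `2 ^ k * l`. -/
def dyadicDilate (d : ℕ) (a : Fin d → ℝ) (l : ℝ) (k : ℕ) : Set (EuclideanSpace ℝ (Fin d)) :=
  cube d (fun i => a i - (2 ^ k - 1) * l / 2) (2 ^ k * l)

theorem dyadicDilate_zero : dyadicDilate d a l 0 = cube d a l := by
  simp [dyadicDilate]

theorem dyadicDilate_mono (hl : 0 < l) : Monotone (dyadicDilate d a l) := by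
  refine monotone_nat_of_le_succ fun k u hu i => ?_
  have h := hu i
  have hk : (0 : ℝ) < 2 ^ k * l := by positivity
  simp only [Set.mem_Icc, pow_succ] at h ⊢
  constructor <;> nlinarith

theorem mem_dyadicDilate (hl : 0 < l) (hx : x ∈ cube d a l) (k : ℕ) : x ∈ dyadicDilate d a l k :=
  dyadicDilate_mono hl k.zero_le (by rwa [dyadicDilate_zero])

theorem volume_dyadicDilate (hl : 0 < l) (k : ℕ) :
    volume (dyadicDilate d a l k) = ENNReal.ofReal ((2 ^ k * l) ^ d) :=
  volume_cube (by positivity)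

theorem volume_dyadicDilate_succ (hl : 0 < l) (k : ℕ) :
    volume (dyadicDilate d a l (k + 1)) = 2 ^ d * volume (dyadicDilate d a l k) := by
  rw [volume_dyadicDilate hl, volume_dyadicDilate hl, pow_succ', mul_assoc, mul_pow,
    ENNReal.ofReal_mul (by positivity), ENNReal.ofReal_pow zero_le_two, ENNReal.ofReal_ofNat]

theorem le_norm_sub_of_notMem_dyadicDilate (hl : 0 < l) {y u : EuclideanSpace ℝ (Fin d)}
    (hy : y ∈ cube d a l) {k : ℕ} (hu : u ∉ dyadicDilate d a l (k + 1)) :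
    2 ^ k * l / 2 ≤ ‖y - u‖ := by
  simp only [dyadicDilate, cube, Set.mem_ofPred_eq, not_forall, Set.mem_Icc, not_and_or,
    not_le] at hu
  obtain ⟨i, hi⟩ := hu
  have hn : |y i - u i| ≤ ‖y - u‖ := PiLp.norm_apply_le (y - u) i
  have hyi := hy i
  have hk : l ≤ 2 ^ k * l := le_mul_of_one_le_left hl.le (one_le_pow₀ one_le_two)
  rw [Set.mem_Icc] at hyi
  rw [pow_succ] at hi
  refine le_trans ?_ hn
  rcases hi with hi | hi
  · exact le_trans (by linarith) (le_abs_self _)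
  · exact le_trans (by linarith) (neg_le_abs _)

theorem exists_mem_dyadicDilate (hl : 0 < l) (u : EuclideanSpace ℝ (Fin d)) :
    ∃ k, u ∈ dyadicDilate d a l k := by
  by_contra! hu
  have hy : WithLp.toLp 2 a ∈ cube d a l := fun i => by simp [hl.le]
  obtain ⟨k, hk⟩ := pow_unbounded_of_one_lt (2 * ‖WithLp.toLp 2 a - u‖ / l) one_lt_two
  have h := le_norm_sub_of_notMem_dyadicDilate hl hy (hu (k + 1))
  rw [div_lt_iff₀ hl] at hk
  linarith

theorem enorm_average_dyadicDilate_succ_sub_le (hf : LocallyIntegrable f volume) (hl : 0 < l)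
    (hx : x ∈ cube d a l) (k : ℕ) :
    ‖(⨍ v in dyadicDilate d a l k, f v) - ⨍ v in dyadicDilate d a l (k + 1), f v‖ₑ ≤
      2 ^ d * sharpMaximal d f x := by
  have hv0 : volume (dyadicDilate d a l k) ≠ 0 := by
    rw [volume_dyadicDilate hl]
    simp only [ne_eq, ENNReal.ofReal_eq_zero, not_le]
    positivity
  have hvt : volume (dyadicDilate d a l k) ≠ ⊤ := isCompact_cube.measure_lt_top.ne
  have : NeZero (volume.restrict (dyadicDilate d a l k)) := ⟨by simpa using hv0⟩
  have : IsFiniteMeasure (volume.restrict (dyadicDilate d a l k)) :=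
    isFiniteMeasure_restrict.2 hvt
  have hfi : Integrable f (volume.restrict (dyadicDilate d a l k)) :=
    hf.integrableOn_isCompact isCompact_cube
  refine (enorm_average_sub_le hfi _).trans ?_
  rw [Measure.restrict_apply_univ, ← ENNReal.div_eq_inv_mul]
  refine ENNReal.div_le_of_le_mul ?_
  calc _ ≤ ∫⁻ u in dyadicDilate d a l (k + 1),
        ‖f u - ⨍ v in dyadicDilate d a l (k + 1), f v‖ₑ :=
        lintegral_mono_set (dyadicDilate_mono hl k.le_succ)
    _ ≤ volume (dyadicDilate d a l (k + 1)) * sharpMaximal d f x :=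
        lintegral_cube_sub_average_le hf.aestronglyMeasurable (by positivity)
          (mem_dyadicDilate hl hx (k + 1))
    _ = _ := by
        rw [volume_dyadicDilate_succ hl]
        ring

theorem enorm_sub_le_of_enorm_sub_succ_le {m : ℕ → ℂ} {B : ℝ≥0∞}
    (hm : ∀ k, ‖m k - m (k + 1)‖ₑ ≤ B) (j k : ℕ) : ‖m (j + k) - m j‖ₑ ≤ k * B := by
  induction k with
  | zero => simp
  | succ k ih =>
    calc ‖m (j + (k + 1)) - m j‖ₑ
        = ‖(m (j + k) - m j) - (m (j + k) - m (j + k + 1))‖ₑ := by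
          rw [← add_assoc]
          congr 1
          ring
      _ ≤ k * B + B := enorm_sub_le.trans (add_le_add ih (hm _))
      _ = _ := by
          push_cast
          ring

theorem lintegral_dyadicDilate_sub_average_le (hf : LocallyIntegrable f volume) (hl : 0 < l)
    (hx : x ∈ cube d a l) (j k : ℕ) :
    ∫⁻ u in dyadicDilate d a l (j + k), ‖f u - ⨍ v in dyadicDilate d a l j, f v‖ₑ ≤
      volume (dyadicDilate d a l (j + k)) * ((1 + k * 2 ^ d) * sharpMaximal d f x) := by
  have hdiff := enorm_sub_le_of_enorm_sub_succ_le
    (enorm_average_dyadicDilate_succ_sub_le hf hl hx) j k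
  set m := ⨍ v in dyadicDilate d a l (j + k), f v with hm
  set c := ⨍ v in dyadicDilate d a l j, f v
  calc _ ≤ ∫⁻ u in dyadicDilate d a l (j + k), (‖f u - m‖ₑ + ‖m - c‖ₑ) := by
        refine lintegral_mono fun u => ?_
        rw [← sub_add_sub_cancel (f u) m c]
        exact enorm_add_le _ _
    _ = (∫⁻ u in dyadicDilate d a l (j + k), ‖f u - m‖ₑ) +
        ‖m - c‖ₑ * volume (dyadicDilate d a l (j + k)) := by
        rw [lintegral_add_right _ measurable_const, setLIntegral_const]
    _ ≤ volume (dyadicDilate d a l (j + k)) * sharpMaximal d f x +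
        k * (2 ^ d * sharpMaximal d f x) * volume (dyadicDilate d a l (j + k)) := by
        gcongr
        exact lintegral_cube_sub_average_le hf.aestronglyMeasurable (by positivity)
          (mem_dyadicDilate hl hx _)
    _ = _ := by ring

end Cubes

section Decomposition

variable {d : ℕ} {ε δ : ℝ} {φ f : EuclideanSpace ℝ (Fin d) → ℂ} {a : Fin d → ℝ} {l t : ℝ}
  {x : EuclideanSpace ℝ (Fin d)}

theorem MemHClass.norm_phiDil_le_of_le_norm (hφ : MemHClass d ε δ φ) (hε : 0 < ε) (ht : 0 < t)
    {ρ : ℝ} (hρ : 0 < ρ) {z : EuclideanSpace ℝ (Fin d)} (hz : ρ ≤ ‖z‖) :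
    ‖phiDil φ t z‖ ≤ t ^ ε * ρ ^ (-((d : ℝ) + ε)) := by
  have hd : (0 : ℝ) ≤ d := d.cast_nonneg
  rw [phiDil, norm_mul, norm_inv, norm_pow, Complex.norm_real, Real.norm_of_nonneg ht.le]
  calc (t ^ d)⁻¹ * ‖φ (t⁻¹ • z)‖ ≤ (t ^ d)⁻¹ * (1 + ‖t⁻¹ • z‖) ^ (-((d : ℝ) + ε)) := by
        gcongr
        exact hφ.1 _
    _ ≤ (t ^ d)⁻¹ * (ρ / t) ^ (-((d : ℝ) + ε)) := by
        gcongr ?_ * ?_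
        refine Real.rpow_le_rpow_of_nonpos (by positivity) ?_ (by linarith)
        rw [norm_smul, norm_inv, Real.norm_of_nonneg ht.le, ← div_eq_inv_mul]
        have : ρ / t ≤ ‖z‖ / t := by gcongr
        linarith
    _ = _ := by
        rw [Real.div_rpow hρ.le ht.le, Real.rpow_neg ht.le, Real.rpow_add ht, Real.rpow_natCast]
        field_simp

theorem tsum_geometric_weight_ne_top (d : ℕ) {ε : ℝ} (hε : 0 < ε) :
    ∑' k : ℕ, ENNReal.ofReal (2 ^ ((d : ℝ) + ε) * 4 ^ d * (2 ^ (-ε)) ^ k *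
      (1 + (k + 1) * 2 ^ d)) ≠ ⊤ := by
  have hr : ‖((2 : ℝ) ^ (-ε))‖ < 1 := by
    rw [Real.norm_of_nonneg (by positivity)]
    exact Real.rpow_lt_one_of_one_lt_of_neg one_lt_two (by linarith)
  have h0 := summable_geometric_of_norm_lt_one hr
  have h1 := summable_pow_mul_geometric_of_norm_lt_one 1 hr
  have hs : Summable fun k : ℕ => (2 : ℝ) ^ ((d : ℝ) + ε) * 4 ^ d * (2 ^ (-ε)) ^ k *
      (1 + (k + 1) * 2 ^ d) := by
    refine (((h0.mul_left (1 + 2 ^ d)).add (h1.mul_left (2 ^ d))).mul_left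
      ((2 : ℝ) ^ ((d : ℝ) + ε) * 4 ^ d)).congr fun k => ?_
    ring
  exact hs.tsum_ofReal_ne_top

/-- The part of `f` away from twice a cube contributes at most `(t / l) ^ ε` times the sharp
maximal function to `φ_t * f` on the cube. -/
theorem enorm_phiConv_indicator_compl_le (hφ : MemHClass d ε δ φ) (hε : 0 < ε)
    (hf : LocallyIntegrable f volume) (hl : 0 < l) (hx : x ∈ cube d a l)
    {y : EuclideanSpace ℝ (Fin d)} (hy : y ∈ cube d a l) (ht : 0 < t) :
    ‖phiConv φ ((dyadicDilate d a l 1)ᶜ.indicator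
        fun u => f u - ⨍ v in dyadicDilate d a l 1, f v) t y‖ₑ ≤
      ENNReal.ofReal ((t / l) ^ ε) * ((∑' k : ℕ, ENNReal.ofReal (2 ^ ((d : ℝ) + ε) * 4 ^ d *
        (2 ^ (-ε)) ^ k * (1 + (k + 1) * 2 ^ d))) * sharpMaximal d f x) := by
  set c := ⨍ v in dyadicDilate d a l 1, f v
  set A := sharpMaximal d f x
  have hsub : (dyadicDilate d a l 1)ᶜ ⊆
      ⋃ k : ℕ, dyadicDilate d a l (1 + (k + 1)) \ dyadicDilate d a l (k + 1) := by
    classical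
    intro u hu
    have hex := exists_mem_dyadicDilate (a := a) hl u
    have hfind := Nat.find_spec hex
    have h1 : 1 < Nat.find hex := by
      by_contra! h
      exact hu (dyadicDilate_mono hl h hfind)
    refine Set.mem_iUnion.2 ⟨Nat.find hex - 2, ?_, ?_⟩
    · convert hfind using 2
      omega
    · exact Nat.find_min hex (by omega)
  have hannulus : ∀ k : ℕ,
      ∫⁻ u in dyadicDilate d a l (1 + (k + 1)) \ dyadicDilate d a l (k + 1),
        ‖phiDil φ t (y - u)‖ₑ * ‖f u - c‖ₑ ≤
      ENNReal.ofReal ((t / l) ^ ε) * (ENNReal.ofReal (2 ^ ((d : ℝ) + ε) * 4 ^ d *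
        (2 ^ (-ε)) ^ k * (1 + (k + 1) * 2 ^ d)) * A) := by
    intro k
    have hρ : 0 < 2 ^ k * l / 2 := by positivity
    calc _ ≤ ∫⁻ u in dyadicDilate d a l (1 + (k + 1)) \ dyadicDilate d a l (k + 1),
          ENNReal.ofReal (t ^ ε * (2 ^ k * l / 2) ^ (-((d : ℝ) + ε))) * ‖f u - c‖ₑ := by
          refine setLIntegral_mono' (measurableSet_cube.diff measurableSet_cube) fun u hu => ?_
          gcongr
          rw [← ofReal_norm]
          exact ENNReal.ofReal_le_ofReal (hφ.norm_phiDil_le_of_le_norm hε ht hρ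
            (le_norm_sub_of_notMem_dyadicDilate hl hy hu.2))
      _ ≤ ENNReal.ofReal (t ^ ε * (2 ^ k * l / 2) ^ (-((d : ℝ) + ε))) *
          ∫⁻ u in dyadicDilate d a l (1 + (k + 1)), ‖f u - c‖ₑ := by
          rw [lintegral_const_mul' _ _ ofReal_ne_top]
          gcongr
          exact Set.sdiff_subset
      _ ≤ ENNReal.ofReal (t ^ ε * (2 ^ k * l / 2) ^ (-((d : ℝ) + ε))) *
          (volume (dyadicDilate d a l (1 + (k + 1))) * ((1 + (k + 1 : ℕ) * 2 ^ d) * A)) := by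
          gcongr
          exact lintegral_dyadicDilate_sub_average_le hf hl hx 1 (k + 1)
      _ = ENNReal.ofReal (t ^ ε * (2 ^ k * l / 2) ^ (-((d : ℝ) + ε)) *
          (2 ^ (1 + (k + 1)) * l) ^ d * (1 + (k + 1) * 2 ^ d)) * A := by
          have h1 : ((1 + (k + 1 : ℕ) * 2 ^ d : ℝ≥0∞)) =
              ENNReal.ofReal (1 + (k + 1) * 2 ^ d) := by
            rw [ENNReal.ofReal_add zero_le_one (by positivity),
              ENNReal.ofReal_mul (by positivity), ENNReal.ofReal_pow zero_le_two,
              ← Nat.cast_succ, ENNReal.ofReal_natCast]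
            simp
          rw [h1, volume_dyadicDilate hl, ← mul_assoc, ← mul_assoc,
            ← ENNReal.ofReal_mul (by positivity), ← ENNReal.ofReal_mul (by positivity)]
      _ = _ := by
          rw [← mul_assoc, ← ENNReal.ofReal_mul (by positivity)]
          congr 2
          have h2 : ((2 : ℝ) ^ (-ε)) ^ k = (2 ^ k) ^ (-ε) := by
            rw [← Real.rpow_natCast, ← Real.rpow_natCast, ← Real.rpow_mul zero_le_two,
              ← Real.rpow_mul zero_le_two, mul_comm]
          have h4 : (4 : ℝ) ^ d = (2 ^ 2) ^ d := by norm_num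
          rw [h2, h4, Real.div_rpow ht.le hl.le, Real.div_rpow (by positivity) zero_le_two,
            Real.mul_rpow (by positivity) hl.le, show 1 + (k + 1) = k + 2 by ring, pow_add,
            mul_pow, mul_pow]
          simp only [Real.rpow_neg (pow_pos (zero_lt_two' ℝ) k).le, Real.rpow_neg hl.le,
            Real.rpow_neg zero_le_two, Real.rpow_add hl, Real.rpow_add (pow_pos (zero_lt_two' ℝ) k),
            Real.rpow_natCast]
          field_simp
  calc _ ≤ ∫⁻ u, ‖phiDil φ t (y - u) * (dyadicDilate d a l 1)ᶜ.indicator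
        (fun u => f u - c) u‖ₑ := enorm_integral_le_lintegral_enorm _
    _ = ∫⁻ u in (dyadicDilate d a l 1)ᶜ, ‖phiDil φ t (y - u)‖ₑ * ‖f u - c‖ₑ := by
        have hm : MeasurableSet (dyadicDilate d a l 1) := measurableSet_cube
        rw [← lintegral_indicator hm.compl]
        refine lintegral_congr fun u => ?_
        by_cases hu : u ∈ (dyadicDilate d a l 1)ᶜ
        · rw [Set.indicator_of_mem hu, Set.indicator_of_mem hu, enorm_mul]
        · rw [Set.indicator_of_notMem hu, Set.indicator_of_notMem hu, mul_zero, enorm_zero]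
    _ ≤ ∑' k : ℕ, ∫⁻ u in dyadicDilate d a l (1 + (k + 1)) \ dyadicDilate d a l (k + 1),
        ‖phiDil φ t (y - u)‖ₑ * ‖f u - c‖ₑ :=
        (lintegral_mono_set hsub).trans (lintegral_iUnion_le _ _)
    _ ≤ _ := ENNReal.tsum_le_tsum hannulus
    _ = _ := by rw [ENNReal.tsum_mul_left, ENNReal.tsum_mul_right]

theorem phiConv_eq_add_indicator (hφ : MemHClass d ε δ φ) (hε : 0 < ε) (hδ : 0 < δ) (ht : 0 < t)
    {y : EuclideanSpace ℝ (Fin d)} (hf : Integrable fun u => phiDil φ t (y - u) * f u)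
    {s : Set (EuclideanSpace ℝ (Fin d))} (hs : MeasurableSet s) (c : ℂ) :
    phiConv φ f t y = phiConv φ (s.indicator fun u => f u - c) t y +
      phiConv φ (sᶜ.indicator fun u => f u - c) t y := by
  have hD : Integrable fun u => phiDil φ t (y - u) :=
    (hφ.integrable_phiDil hε hδ ht).comp_sub_left y
  have hg : Integrable fun u => phiDil φ t (y - u) * (f u - c) := by
    simp only [mul_sub]
    exact hf.sub (hD.mul_const c)
  have h0 : phiConv φ f t y = ∫ u, phiDil φ t (y - u) * (f u - c) := by
    simp only [mul_sub]
    rw [integral_sub hf (hD.mul_const c), integral_mul_const,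
      integral_sub_left_eq_self (phiDil φ t) volume y, hφ.integral_phiDil, zero_mul, sub_zero,
      phiConv]
  have hind : ∀ r : Set (EuclideanSpace ℝ (Fin d)), MeasurableSet r →
      phiConv φ (r.indicator fun u => f u - c) t y =
        ∫ u in r, phiDil φ t (y - u) * (f u - c) := by
    intro r hr
    rw [← integral_indicator hr, phiConv]
    congr 1 with u
    by_cases hu : u ∈ r <;> simp [hu]
  rw [h0, hind s hs, hind sᶜ hs.compl, integral_add_compl hs hg]

theorem enorm_add_sq_le (z w : ℂ) : ‖z + w‖ₑ ^ 2 ≤ 2 * ‖z‖ₑ ^ 2 + 2 * ‖w‖ₑ ^ 2 := by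
  have h : ‖z + w‖₊ ^ 2 ≤ 2 * ‖z‖₊ ^ 2 + 2 * ‖w‖₊ ^ 2 :=
    calc ‖z + w‖₊ ^ 2 ≤ (‖z‖₊ + ‖w‖₊) ^ 2 := by
          gcongr
          exact nnnorm_add_le z w
      _ ≤ _ := by
          rw [← mul_add]
          exact add_sq_le
  change (‖z + w‖₊ : ℝ≥0∞) ^ 2 ≤ 2 * (‖z‖₊ : ℝ≥0∞) ^ 2 + 2 * (‖w‖₊ : ℝ≥0∞) ^ 2
  exact_mod_cast h

theorem lintegral_carleson_box_le {K S : ℝ≥0∞}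
    (hK : ∀ h : EuclideanSpace ℝ (Fin d) → ℂ, Integrable h → MemLp h 2 →
      ∫⁻ t in Set.Ioi (0 : ℝ), (∫⁻ y, ‖phiConv φ h t y‖ₑ ^ 2) / ENNReal.ofReal t ≤
        K * ∫⁻ y, ‖h y‖ₑ ^ 2)
    (hS : ∑' k : ℕ, ENNReal.ofReal (2 ^ ((d : ℝ) + ε) * 4 ^ d * (2 ^ (-ε)) ^ k *
      (1 + (k + 1) * 2 ^ d)) = S)
    (hφ : MemHClass d ε δ φ) (hε : 0 < ε) (hδ : 0 < δ)
    (hf : LocallyIntegrable f volume)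
    (hconv : ∀ t : ℝ, 0 < t → ∀ x, Integrable (fun y => phiDil φ t (x - y) * f y) volume)
    (hl : 0 < l) (hx : x ∈ cube d a l) (hA : sharpMaximal d f x ≠ ⊤) :
    ∫⁻ t in Set.Ioc 0 l, (∫⁻ y in cube d a l, ‖phiConv φ f t y‖ₑ ^ 2) / ENNReal.ofReal t ≤
      volume (cube d a l) * ((2 * K * 2 ^ d + 2 * S ^ 2 * ENNReal.ofReal (1 / (2 * ε))) *
        sharpMaximal d f x ^ 2) := by
  set A := sharpMaximal d f x with hAdef
  set Q := dyadicDilate d a l 1 with hQ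
  have hQm : MeasurableSet Q := measurableSet_cube
  set c := ⨍ v in Q, f v with hc
  set f₁ := Q.indicator fun u => f u - c with hf₁
  set f₂ := Qᶜ.indicator fun u => f u - c with hf₂
  have hvolQ : volume Q = 2 ^ d * volume (cube d a l) := by
    rw [hQ, volume_dyadicDilate_succ hl, dyadicDilate_zero]
  have hf₁sq : ∫⁻ u, ‖f₁ u‖ₑ ^ 2 ≤ 2 ^ d * volume (cube d a l) * A ^ 2 := by
    have : ∀ u, ‖f₁ u‖ₑ ^ 2 = Q.indicator (fun u => ‖f u - c‖ₑ ^ 2) u := fun u => by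
      by_cases hu : u ∈ Q <;> simp [hf₁, hu]
    simp only [this]
    rw [lintegral_indicator hQm, ← hvolQ]
    exact lintegral_cube_sub_average_sq_le (by positivity) (mem_dyadicDilate hl hx 1)
  have hf₁i : Integrable f₁ := by
    rw [hf₁, integrable_indicator_iff hQm]
    exact (hf.integrableOn_isCompact isCompact_cube).sub
      (integrableOn_const isCompact_cube.measure_lt_top.ne)
  have hf₁2 : MemLp f₁ 2 := by
    refine ⟨hf₁i.aestronglyMeasurable, ?_⟩
    rw [eLpNorm_lt_top_iff_lintegral_rpow_enorm_lt_top two_ne_zero ofNat_ne_top]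
    simp only [toReal_ofNat, ENNReal.rpow_ofNat]
    refine hf₁sq.trans_lt ?_
    have := (isCompact_cube (d := d) (a := a) (l := l)).measure_lt_top (μ := volume)
    finiteness
  have hbox : ∀ t ∈ Set.Ioc 0 l,
      (∫⁻ y in cube d a l, ‖phiConv φ f t y‖ₑ ^ 2) / ENNReal.ofReal t ≤
        2 * ((∫⁻ y, ‖phiConv φ f₁ t y‖ₑ ^ 2) / ENNReal.ofReal t) +
          2 * (S * A) ^ 2 * volume (cube d a l) * ENNReal.ofReal (l ^ (-(2 * ε))) *
            ENNReal.ofReal (t ^ (2 * ε - 1)) := by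
    intro t ht
    have hpow : ENNReal.ofReal (l ^ (-(2 * ε))) * ENNReal.ofReal (t ^ (2 * ε - 1)) =
        ENNReal.ofReal ((t / l) ^ ε) ^ 2 / ENNReal.ofReal t := by
      rw [← ENNReal.ofReal_pow (by have := ht.1.le; positivity), ← ENNReal.ofReal_div_of_pos ht.1,
        ← ENNReal.ofReal_mul (by positivity)]
      congr 1
      rw [Real.div_rpow ht.1.le hl.le, Real.rpow_sub_one ht.1.ne', mul_comm 2 ε,
        Real.rpow_neg hl.le, Real.rpow_mul ht.1.le, Real.rpow_mul hl.le, Real.rpow_two,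
        Real.rpow_two]
      field_simp
    calc _ ≤ (∫⁻ y in cube d a l, (2 * ‖phiConv φ f₁ t y‖ₑ ^ 2 +
          2 * (ENNReal.ofReal ((t / l) ^ ε) * (S * A)) ^ 2)) / ENNReal.ofReal t := by
          gcongr ?_ / _
          refine setLIntegral_mono' measurableSet_cube fun y hy => ?_
          rw [phiConv_eq_add_indicator hφ hε hδ ht.1 (hconv t ht.1 y) hQm c]
          refine (enorm_add_sq_le _ _).trans ?_
          gcongr
          rw [← hS]
          exact enorm_phiConv_indicator_compl_le hφ hε hf hl hx hy ht.1
      _ ≤ (2 * (∫⁻ y, ‖phiConv φ f₁ t y‖ₑ ^ 2) +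
          2 * (ENNReal.ofReal ((t / l) ^ ε) * (S * A)) ^ 2 * volume (cube d a l)) /
            ENNReal.ofReal t := by
          rw [lintegral_add_right _ measurable_const, setLIntegral_const,
            lintegral_const_mul' _ _ ofNat_ne_top]
          gcongr
          exact Measure.restrict_le_self
      _ = _ := by
          rw [mul_assoc _ (ENNReal.ofReal (l ^ (-(2 * ε)))), hpow, ENNReal.add_div, mul_pow]
          simp only [div_eq_mul_inv]
          ring
  have hmeas : Measurable fun t : ℝ => 2 * (S * A) ^ 2 * volume (cube d a l) *
      ENNReal.ofReal (l ^ (-(2 * ε))) * ENNReal.ofReal (t ^ (2 * ε - 1)) := by fun_prop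
  have hint : ENNReal.ofReal (l ^ (-(2 * ε))) * ENNReal.ofReal (l ^ (2 * ε) / (2 * ε)) =
      ENNReal.ofReal (1 / (2 * ε)) := by
    rw [← ENNReal.ofReal_mul (by positivity), Real.rpow_neg hl.le]
    congr 1
    field_simp
  calc _ ≤ ∫⁻ t in Set.Ioc 0 l, (2 * ((∫⁻ y, ‖phiConv φ f₁ t y‖ₑ ^ 2) / ENNReal.ofReal t) +
          2 * (S * A) ^ 2 * volume (cube d a l) * ENNReal.ofReal (l ^ (-(2 * ε))) *
            ENNReal.ofReal (t ^ (2 * ε - 1))) := setLIntegral_mono' measurableSet_Ioc hbox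
    _ = 2 * (∫⁻ t in Set.Ioc 0 l, (∫⁻ y, ‖phiConv φ f₁ t y‖ₑ ^ 2) / ENNReal.ofReal t) +
          2 * (S * A) ^ 2 * volume (cube d a l) * ENNReal.ofReal (1 / (2 * ε)) := by
        rw [lintegral_add_right _ hmeas, lintegral_const_mul' _ _ ofNat_ne_top,
          lintegral_const_mul _ (by fun_prop), lintegral_Ioc_rpow hl (by positivity), mul_assoc _
          (ENNReal.ofReal (l ^ (-(2 * ε)))), hint]
    _ ≤ 2 * (K * (2 ^ d * volume (cube d a l) * A ^ 2)) +
          2 * (S * A) ^ 2 * volume (cube d a l) * ENNReal.ofReal (1 / (2 * ε)) := by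
        gcongr
        calc _ ≤ _ := lintegral_mono_set Set.Ioc_subset_Ioi_self
          _ ≤ _ := hK f₁ hf₁i hf₁2
          _ ≤ _ := by gcongr
    _ = _ := by ring

end Decomposition

/-- For `φ ∈ H_{ε,δ}` the Carleson maximal function is pointwise dominated by the sharp
maximal function: `C^φ(f)(x) ≲_{d,ε,δ} f^♯(x)`, for every locally integrable `f` that is
nice enough for all the convolutions `φ_t * f` to be absolutely convergent. -/
theorem carlesonMax_le_sharpMaximal :
    ∀ (d : ℕ), 0 < d → ∀ ε δ : ℝ, 0 < ε → 0 < δ →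
      ∃ C : ℝ, 0 < C ∧ ∀ φ : EuclideanSpace ℝ (Fin d) → ℂ, MemHClass d ε δ φ →
        ∀ f : EuclideanSpace ℝ (Fin d) → ℂ, LocallyIntegrable f volume →
          (∀ t : ℝ, 0 < t → ∀ x, Integrable (fun y => phiDil φ t (x - y) * f y) volume) →
          ∀ x, carlesonMax d φ f x ≤ ENNReal.ofReal C * sharpMaximal d f x := by
  intro d _ ε δ hε hδ
  obtain ⟨K, hK, hKφ⟩ := exists_lintegral_phiConv_sq_le d hε hδ
  obtain ⟨S, hS⟩ : ∃ S : ℝ≥0∞, ∑' k : ℕ, ENNReal.ofReal (2 ^ ((d : ℝ) + ε) * 4 ^ d *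
    (2 ^ (-ε)) ^ k * (1 + (k + 1) * 2 ^ d)) = S := ⟨_, rfl⟩
  have hSt : S ≠ ⊤ := hS ▸ tsum_geometric_weight_ne_top d hε
  set M : ℝ≥0∞ := 2 * K * 2 ^ d + 2 * S ^ 2 * ENNReal.ofReal (1 / (2 * ε)) with hM
  have hMt : M ^ (1 / 2 : ℝ) ≠ ⊤ := ENNReal.rpow_ne_top_of_nonneg (by norm_num) (by finiteness)
  have hC : 0 < (M ^ (1 / 2 : ℝ)).toReal + 1 := by positivity
  refine ⟨_, hC, fun φ hφ f hf hconv x => ?_⟩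
  by_cases hA : sharpMaximal d f x = ⊤
  · rw [hA, ENNReal.mul_top (by simpa using hC)]
    exact le_top
  refine iSup₂_le fun a l => iSup₂_le fun hl hx => ?_
  have key := lintegral_carleson_box_le (hKφ φ hφ) hS hφ hε hδ hf hconv hl hx hA
  rw [← hM] at key
  calc _ ≤ (M * sharpMaximal d f x ^ 2) ^ (1 / 2 : ℝ) := by
        refine ENNReal.rpow_le_rpow ?_ (by norm_num)
        rw [← ENNReal.div_eq_inv_mul]
        exact ENNReal.div_le_of_le_mul' key
    _ = M ^ (1 / 2 : ℝ) * sharpMaximal d f x := by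
        rw [ENNReal.mul_rpow_of_nonneg _ _ (by norm_num), ← ENNReal.rpow_natCast,
          ← ENNReal.rpow_mul]
        norm_num
    _ ≤ _ := by
        gcongr
        rw [ENNReal.ofReal_add (by positivity) zero_le_one, ENNReal.ofReal_toReal hMt]
        exact le_self_add
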